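/- arXiv:1912.02515 — 2 statements merged into one kernel-verified Lean document; each statement's English description precedes it below -/
import Mathlib

section
/- A countable simplicial complex is a Rado complex if and only if it is ample. -/
/-- An (abstract) simplicial complex with vertices drawn from `ℕ`:
a set of nonempty finite subsets of `ℕ` (the simplexes) closed under
passing to nonempty subsets.  The vertex set `V(X)` is the set of `v`
with `{v}` a simplex. -/
structure SComplex where
  faces : Set (Finset ℕ)
  nonempty_of_mem : ∀ s ∈ faces, s.Nonempty
  down_closed : ∀ s ∈ faces, ∀ t ⊆ s, t.Nonempty → t ∈ faces

namespace SComplex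

/-- The vertex set of a simplicial complex. -/
def vertexSet (X : SComplex) : Set ℕ := {v | {v} ∈ X.faces}

/-- The subcomplex of `X` induced on a set `U` of vertices. -/
def induced (X : SComplex) (U : Set ℕ) : SComplex where
  faces := {s | s ∈ X.faces ∧ (↑s : Set ℕ) ⊆ U}
  nonempty_of_mem := fun s hs => X.nonempty_of_mem s hs.1
  down_closed := fun s hs t hts ht =>
    ⟨X.down_closed s hs.1 t hts ht,
     fun x hx => hs.2 (Finset.mem_coe.mpr (hts (Finset.mem_coe.mp hx)))⟩

/-- The link of a vertex `v`: all simplexes `σ` with `v ∉ σ` and `σ ∪ {v}` a simplex. -/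
def link (X : SComplex) (v : ℕ) : SComplex where
  faces := {s | s ∈ X.faces ∧ v ∉ s ∧ insert v s ∈ X.faces}
  nonempty_of_mem := fun s hs => X.nonempty_of_mem s hs.1
  down_closed := fun s hs t hts ht =>
    ⟨X.down_closed s hs.1 t hts ht,
     fun hv => hs.2.1 (hts hv),
     X.down_closed _ hs.2.2 _ (Finset.insert_subset_insert v hts)
       (Finset.insert_nonempty v t)⟩

/-- `IsIso X Y f` : the map `f` is an isomorphism of simplicial complexes from `X` to `Y`,
i.e. a bijection of the vertex sets which induces a bijection between the sets of simplexes. -/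
def IsIso (X Y : SComplex) (f : ℕ → ℕ) : Prop :=
  Set.BijOn f X.vertexSet Y.vertexSet ∧
    ∀ s : Finset ℕ, (↑s : Set ℕ) ⊆ X.vertexSet → (s ∈ X.faces ↔ s.image f ∈ Y.faces)

/-- Two simplicial complexes are isomorphic. -/
def Isomorphic (X Y : SComplex) : Prop := ∃ f, IsIso X Y f

/-- `X` is universal: every countable simplicial complex is isomorphic to an induced
subcomplex of `X`. -/
def Universal (X : SComplex) : Prop :=
  ∀ Y : SComplex, Y.vertexSet.Countable →
    ∃ U ⊆ X.vertexSet, Isomorphic Y (X.induced U)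

/-- `X` is homogeneous: every isomorphism between finite induced subcomplexes of `X`
extends to an isomorphism of `X` onto itself. -/
def Homogeneous (X : SComplex) : Prop :=
  ∀ U U' : Set ℕ, U.Finite → U'.Finite → U ⊆ X.vertexSet → U' ⊆ X.vertexSet →
    ∀ f : ℕ → ℕ, IsIso (X.induced U) (X.induced U') f →
      ∃ F : ℕ → ℕ, IsIso X X F ∧ Set.EqOn F f U

/-- A Rado complex: a countable simplicial complex which is universal and homogeneous. -/
def IsRado (X : SComplex) : Prop :=
  X.vertexSet.Countable ∧ Universal X ∧ Homogeneous X

/-- The ampleness condition: for every finite `U ⊆ V(X)` and every subcomplex `A` of the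
induced complex `X_U` there is a vertex `v ∈ V(X) - U` with `Lk_X(v) ∩ X_U = A`. -/
def AmpleProp (X : SComplex) : Prop :=
  ∀ U : Set ℕ, U.Finite → U ⊆ X.vertexSet →
    ∀ A : SComplex, A.faces ⊆ (X.induced U).faces →
      ∃ v ∈ X.vertexSet \ U, (X.link v).faces ∩ (X.induced U).faces = A.faces

/-- An ample complex: a countable simplicial complex satisfying the ampleness condition. -/
def IsAmple (X : SComplex) : Prop := X.vertexSet.Countable ∧ AmpleProp X

/-- `L'` is an induced subcomplex of `L`. -/
def IsInduced (L' L : SComplex) : Prop :=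
  L'.faces ⊆ L.faces ∧ ∀ s ∈ L.faces, (↑s : Set ℕ) ⊆ L'.vertexSet → s ∈ L'.faces

end SComplex

namespace SComplex

theorem vertexSet_induced (X : SComplex) (U : Set ℕ) :
    (X.induced U).vertexSet = U ∩ X.vertexSet := by
  ext v
  simp [vertexSet, induced, and_comm]

/-- A finite partial isomorphism from `X` to `Y`, given by its graph: a finite bijective relation
between vertices of `X` and vertices of `Y` which preserves and reflects simplexes. -/
structure IsPartialIso (X Y : SComplex) (p : Finset (ℕ × ℕ)) : Prop where
  fst_mem : ∀ x ∈ p, x.1 ∈ X.vertexSet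
  snd_mem : ∀ x ∈ p, x.2 ∈ Y.vertexSet
  fst_injOn : Set.InjOn Prod.fst (p : Set (ℕ × ℕ))
  snd_injOn : Set.InjOn Prod.snd (p : Set (ℕ × ℕ))
  mem_faces_iff : ∀ t ⊆ p, t.image Prod.fst ∈ X.faces ↔ t.image Prod.snd ∈ Y.faces

namespace IsPartialIso

variable {X Y : SComplex} {p : Finset (ℕ × ℕ)}

theorem swap (hp : IsPartialIso X Y p) : IsPartialIso Y X (p.image Prod.swap) where
  fst_mem := by
    simp only [Finset.forall_mem_image]
    exact hp.snd_mem
  snd_mem := by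
    simp only [Finset.forall_mem_image]
    exact hp.fst_mem
  fst_injOn := by
    intro x hx y hy h
    simp only [Finset.coe_image, Set.image_swap_eq_preimage_swap, Set.mem_preimage] at hx hy
    exact Prod.swap_injective (hp.snd_injOn hx hy h)
  snd_injOn := by
    intro x hx y hy h
    simp only [Finset.coe_image, Set.image_swap_eq_preimage_swap, Set.mem_preimage] at hx hy
    exact Prod.swap_injective (hp.fst_injOn hx hy h)
  mem_faces_iff := by
    intro t ht
    have hsub : t.image Prod.swap ⊆ p := by
      intro x hx
      obtain ⟨y, hy, rfl⟩ := Finset.mem_image.1 hx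
      obtain ⟨z, hz, rfl⟩ := Finset.mem_image.1 (ht hy)
      simpa using hz
    have h := (hp.mem_faces_iff _ hsub).symm
    rw [Finset.image_image, Finset.image_image] at h
    exact h

/-- Extension of a partial isomorphism into an ample complex by one more vertex. -/
theorem exists_extend_fst (hp : IsPartialIso X Y p) (hY : Y.AmpleProp) {a : ℕ}
    (ha : a ∈ X.vertexSet) : ∃ q, IsPartialIso X Y q ∧ p ⊆ q ∧ ∃ b, (a, b) ∈ q := by
  by_cases hdom : ∃ b, (a, b) ∈ p
  · exact ⟨p, hp, subset_rfl, hdom⟩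
  have hne : ∀ x ∈ p, x.1 ≠ a := by
    rintro ⟨x, y⟩ hx rfl
    exact hdom ⟨y, hx⟩
  let A : SComplex :=
    { faces := {s | s.Nonempty ∧ ∃ t ⊆ p, t.image Prod.snd = s ∧
        insert a (t.image Prod.fst) ∈ X.faces}
      nonempty_of_mem := fun s hs => hs.1
      down_closed := by
        rintro _ ⟨-, t, htp, rfl, ht⟩ s hs hs0
        refine ⟨hs0, t.filter (fun x => x.2 ∈ s), (Finset.filter_subset _ _).trans htp, ?_, ?_⟩
        · ext y
          simp only [Finset.mem_image, Finset.mem_filter]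
          constructor
          · rintro ⟨x, ⟨-, hx⟩, rfl⟩
            exact hx
          · intro hy
            obtain ⟨x, hx, rfl⟩ := Finset.mem_image.1 (hs hy)
            exact ⟨x, ⟨hx, hy⟩, rfl⟩
        · exact X.down_closed _ ht _
            (Finset.insert_subset_insert _ (Finset.image_subset_image (Finset.filter_subset _ _)))
            (Finset.insert_nonempty _ _) }
  obtain ⟨v, ⟨hv, hvU⟩, hlink⟩ := hY (p.image Prod.snd : Finset ℕ) (Finset.finite_toSet _)
    (by
      intro y hy
      obtain ⟨x, hx, rfl⟩ := Finset.mem_image.1 (Finset.mem_coe.1 hy)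
      exact hp.snd_mem x hx) A
    (by
      rintro _ ⟨hs0, t, htp, rfl, ht⟩
      refine ⟨(hp.mem_faces_iff t htp).1 (X.down_closed _ ht _ (Finset.subset_insert _ _) ?_), ?_⟩
      · exact (Finset.image_nonempty.1 hs0).image _
      · exact Finset.coe_subset.2 (Finset.image_subset_image htp))
  have hvne : ∀ x ∈ p, x.2 ≠ v := by
    rintro x hx rfl
    exact hvU (Finset.mem_coe.2 (Finset.mem_image_of_mem _ hx))
  have key : ∀ t ⊆ p, insert a (t.image Prod.fst) ∈ X.faces ↔
      insert v (t.image Prod.snd) ∈ Y.faces := by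
    intro t htp
    rcases t.eq_empty_or_nonempty with rfl | ht0
    · exact iff_of_true ha hv
    have hmem := Set.ext_iff.1 hlink (t.image Prod.snd)
    constructor
    · intro h
      exact (hmem.2 ⟨ht0.image _, t, htp, rfl, h⟩).1.2.2
    · intro h
      have hface : t.image Prod.snd ∈ Y.faces :=
        Y.down_closed _ h _ (Finset.subset_insert _ _) (ht0.image _)
      have hsub := Finset.image_subset_image (f := Prod.snd) htp
      obtain ⟨-, t', ht'p, himg, ht'⟩ := hmem.1
        ⟨⟨hface, fun hv' => hvU (Finset.mem_coe.2 (hsub hv')), h⟩, hface, Finset.coe_subset.2 hsub⟩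
      have : t' = t := by
        apply Finset.coe_injective
        refine (hp.snd_injOn.image_eq_image_iff (Finset.coe_subset.2 ht'p)
          (Finset.coe_subset.2 htp)).1 ?_
        exact_mod_cast himg
      exact this ▸ ht'
  refine ⟨insert (a, v) p, ⟨?_, ?_, ?_, ?_, ?_⟩, Finset.subset_insert _ _, v,
    Finset.mem_insert_self _ _⟩
  · simpa [Finset.forall_mem_insert, ha] using hp.fst_mem
  · simpa [Finset.forall_mem_insert, hv] using hp.snd_mem
  · rw [Finset.coe_insert, Set.injOn_insert fun h => hne _ h rfl]
    refine ⟨hp.fst_injOn, ?_⟩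
    rintro ⟨x, hx, hxa⟩
    exact hne x hx hxa
  · rw [Finset.coe_insert, Set.injOn_insert fun h => hne _ h rfl]
    refine ⟨hp.snd_injOn, ?_⟩
    rintro ⟨x, hx, hxv⟩
    exact hvne x hx hxv
  · intro t ht
    by_cases hat : (a, v) ∈ t
    · rw [← Finset.insert_erase hat, Finset.image_insert, Finset.image_insert]
      exact key _ (Finset.subset_insert_iff.1 ht)
    · exact hp.mem_faces_iff t ((Finset.subset_insert_iff_of_notMem hat).1 ht)

theorem exists_extend_snd (hp : IsPartialIso X Y p) (hX : X.AmpleProp) {b : ℕ}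
    (hb : b ∈ Y.vertexSet) : ∃ q, IsPartialIso X Y q ∧ p ⊆ q ∧ ∃ a, (a, b) ∈ q := by
  obtain ⟨q, hq, hpq, a, ha⟩ := hp.swap.exists_extend_fst hX hb
  refine ⟨q.image Prod.swap, hq.swap, fun x hx => ?_, a, ?_⟩
  · exact Finset.mem_image.2 ⟨x.swap, hpq (Finset.mem_image_of_mem _ hx), x.swap_swap⟩
  · exact Finset.mem_image.2 ⟨_, ha, rfl⟩

/-- Back and forth: a finite partial isomorphism into an ample complex `Y` extends to an embedding
of `X` as an induced subcomplex, and to an isomorphism if `X` is ample as well. -/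
theorem exists_embedding (hp : IsPartialIso X Y p) (hY : Y.AmpleProp) :
    ∃ f : ℕ → ℕ, (∀ x ∈ p, f x.1 = x.2) ∧ Set.MapsTo f X.vertexSet Y.vertexSet ∧
      Set.InjOn f X.vertexSet ∧
      (∀ s : Finset ℕ, (s : Set ℕ) ⊆ X.vertexSet → (s ∈ X.faces ↔ s.image f ∈ Y.faces)) ∧
      (X.AmpleProp → Set.SurjOn f X.vertexSet Y.vertexSet) := by
  let D : ℕ ⊕ ℕ → Order.Cofinal {q : Finset (ℕ × ℕ) // IsPartialIso X Y q} := fun i =>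
    { carrier := {q | Sum.elim (fun a => a ∈ X.vertexSet → ∃ b, (a, b) ∈ q.1)
        (fun b => X.AmpleProp → b ∈ Y.vertexSet → ∃ a, (a, b) ∈ q.1) i}
      isCofinal := by
        rintro ⟨q, hq⟩
        rcases i with a | b
        · by_cases ha : a ∈ X.vertexSet
          · obtain ⟨r, hr, hqr, h⟩ := hq.exists_extend_fst hY ha
            exact ⟨⟨r, hr⟩, fun _ => h, hqr⟩
          · exact ⟨⟨q, hq⟩, fun h => absurd h ha, le_rfl⟩
        · by_cases hb : X.AmpleProp ∧ b ∈ Y.vertexSet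
          · obtain ⟨r, hr, hqr, h⟩ := hq.exists_extend_snd hb.1 hb.2
            exact ⟨⟨r, hr⟩, fun _ _ => h, hqr⟩
          · exact ⟨⟨q, hq⟩, fun h h' => absurd ⟨h, h'⟩ hb, le_rfl⟩ }
  let I := Order.idealOfCofinals ⟨p, hp⟩ D
  have hpI : (⟨p, hp⟩ : {q // IsPartialIso X Y q}) ∈ I := Order.mem_idealOfCofinals _ _
  have hfin : ∀ t : Finset (ℕ × ℕ), (∀ x ∈ t, ∃ q ∈ I, x ∈ q.1) → ∃ q ∈ I, t ⊆ q.1 := by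
    intro t
    induction t using Finset.induction_on with
    | empty => exact fun _ => ⟨_, hpI, Finset.empty_subset _⟩
    | insert x t _ ih =>
      intro h
      obtain ⟨q, hq, htq⟩ := ih fun y hy => h y (Finset.mem_insert_of_mem hy)
      obtain ⟨r, hr, hxr⟩ := h x (Finset.mem_insert_self _ _)
      obtain ⟨u, hu, hqu, hru⟩ := I.directed q hq r hr
      exact ⟨u, hu, Finset.insert_subset (hru hxr) (htq.trans hqu)⟩
  have hpair : ∀ x y : ℕ × ℕ, (∃ q ∈ I, x ∈ q.1) → (∃ q ∈ I, y ∈ q.1) →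
      ∃ q, IsPartialIso X Y q ∧ x ∈ q ∧ y ∈ q := by
    intro x y hx hy
    obtain ⟨q, -, hq⟩ := hfin {x, y} (by
      rw [Finset.forall_mem_insert]
      exact ⟨hx, by simpa only [Finset.mem_singleton, forall_eq] using hy⟩)
    exact ⟨q.1, q.2, hq (by simp), hq (by simp)⟩
  have hdef : ∀ a, ∃ b, a ∈ X.vertexSet → ∃ q ∈ I, (a, b) ∈ q.1 := by
    intro a
    by_cases ha : a ∈ X.vertexSet
    · obtain ⟨q, hq, hqI⟩ := Order.cofinal_meets_idealOfCofinals ⟨p, hp⟩ D (Sum.inl a)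
      obtain ⟨b, hb⟩ := hq ha
      exact ⟨b, fun _ => ⟨q, hqI, hb⟩⟩
    · exact ⟨0, fun h => absurd h ha⟩
  choose f hf using hdef
  have hval : ∀ x : ℕ × ℕ, (∃ q ∈ I, x ∈ q.1) → x.1 ∈ X.vertexSet ∧ f x.1 = x.2 := by
    intro x hx
    have hx1 : x.1 ∈ X.vertexSet := by
      obtain ⟨q, -, hxq⟩ := hx
      exact q.2.fst_mem x hxq
    obtain ⟨q, hq, h1, h2⟩ := hpair _ _ (hf _ hx1) hx
    exact ⟨hx1, congrArg Prod.snd (hq.fst_injOn h1 h2 rfl)⟩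
  refine ⟨f, fun x hx => (hval x ⟨_, hpI, hx⟩).2, ?_, ?_, ?_, ?_⟩
  · intro a ha
    obtain ⟨q, -, h⟩ := hf a ha
    exact q.2.snd_mem _ h
  · intro a ha b hb hab
    obtain ⟨q, hq, h1, h2⟩ := hpair _ _ (hf a ha) (hf b hb)
    exact congrArg Prod.fst (hq.snd_injOn h1 h2 hab)
  · intro s hs
    obtain ⟨q, -, hq⟩ := hfin (s.image fun a => (a, f a)) (by
      simp only [Finset.forall_mem_image]
      exact fun a ha => hf a (hs ha))
    have h := q.2.mem_faces_iff _ hq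
    simpa [Finset.image_image, Function.comp_def] using h
  · intro hX b hb
    obtain ⟨q, hq, hqI⟩ := Order.cofinal_meets_idealOfCofinals ⟨p, hp⟩ D (Sum.inr b)
    obtain ⟨a, ha⟩ := hq hX hb
    exact ⟨a, hval (a, b) ⟨q, hqI, ha⟩⟩

theorem empty (X Y : SComplex) : IsPartialIso X Y ∅ where
  fst_mem := by simp
  snd_mem := by simp
  fst_injOn := by simp
  snd_injOn := by simp
  mem_faces_iff := by
    intro t ht
    rw [Finset.subset_empty.1 ht]
    exact iff_of_false (fun h => by simpa using X.nonempty_of_mem _ h)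
      (fun h => by simpa using Y.nonempty_of_mem _ h)

end IsPartialIso

theorem AmpleProp.universal {X : SComplex} (hX : X.AmpleProp) : X.Universal := by
  intro Y _
  obtain ⟨f, -, hmaps, hinj, hface, -⟩ := (IsPartialIso.empty Y X).exists_embedding hX
  refine ⟨f '' Y.vertexSet, hmaps.image_subset, f, ?_, fun s hs => ?_⟩
  · rw [vertexSet_induced, Set.inter_eq_left.2 hmaps.image_subset]
    exact hinj.bijOn_image
  · rw [hface s hs]
    refine ⟨fun h => ⟨h, ?_⟩, fun h => h.1⟩
    rw [Finset.coe_image]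
    exact Set.image_mono hs

theorem AmpleProp.homogeneous {X : SComplex} (hX : X.AmpleProp) : X.Homogeneous := by
  intro U U' hU _ hUX hU'X f hf
  obtain ⟨hbij, hface⟩ := hf
  rw [vertexSet_induced, vertexSet_induced, Set.inter_eq_left.2 hUX,
    Set.inter_eq_left.2 hU'X] at hbij
  rw [vertexSet_induced, Set.inter_eq_left.2 hUX] at hface
  have hp : IsPartialIso X X (hU.toFinset.image fun a => (a, f a)) := by
    refine ⟨?_, ?_, ?_, ?_, ?_⟩
    · simp only [Finset.forall_mem_image, Set.Finite.mem_toFinset]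
      exact fun a ha => hUX ha
    · simp only [Finset.forall_mem_image, Set.Finite.mem_toFinset]
      exact fun a ha => hU'X (hbij.mapsTo ha)
    · rw [Finset.coe_image]
      rintro _ ⟨a, -, rfl⟩ _ ⟨b, -, rfl⟩ h
      exact congrArg (fun a => (a, f a)) h
    · rw [Finset.coe_image, hU.coe_toFinset]
      rintro _ ⟨a, ha, rfl⟩ _ ⟨b, hb, rfl⟩ h
      rw [hbij.injOn ha hb h]
    · intro t ht
      obtain ⟨s, hs, rfl⟩ := Finset.subset_image_iff.1 ht
      have hsU : (s : Set ℕ) ⊆ U := by simpa using hs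
      have h1 : (s.image fun a => (a, f a)).image Prod.fst = s := by
        simp [Finset.image_image, Function.comp_def]
      have h2 : (s.image fun a => (a, f a)).image Prod.snd = s.image f := by
        simp [Finset.image_image, Function.comp_def]
      rw [h1, h2]
      have hsU' : ((s.image f : Finset ℕ) : Set ℕ) ⊆ U' := by
        rw [Finset.coe_image]
        exact (hbij.mapsTo.mono_left hsU).image_subset
      exact ⟨fun h => ((hface s hsU).1 ⟨h, hsU⟩).1, fun h => ((hface s hsU).2 ⟨h, hsU'⟩).1⟩
  obtain ⟨F, hF, hmaps, hinj, hFface, hsurj⟩ := hp.exists_embedding hX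
  refine ⟨F, ⟨⟨hmaps, hinj, hsurj hX⟩, hFface⟩, fun a ha => ?_⟩
  exact hF (a, f a) (Finset.mem_image_of_mem _ (hU.mem_toFinset.2 ha))

/-- The subcomplex of `X` induced on `U` together with a cone with apex `w` over a complex `A`. -/
def attachCone (X : SComplex) (U : Set ℕ) (A : SComplex) (w : ℕ) : SComplex where
  faces := {s | s.Nonempty ∧ (w ∉ s → s ∈ (X.induced U).faces) ∧
    (s.erase w ∈ (X.induced U).faces ∩ A.faces ∨ s.erase w = ∅ ∨ w ∉ s)}
  nonempty_of_mem := fun _ hs => hs.1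
  down_closed := by
    rintro s ⟨-, h1, h2⟩ t hts ht
    have hsub := Finset.erase_subset_erase w hts
    by_cases hwt : w ∈ t
    · refine ⟨ht, fun h => absurd hwt h, ?_⟩
      rcases (t.erase w).eq_empty_or_nonempty with h0 | h0
      · exact Or.inr (Or.inl h0)
      rcases h2 with h2 | h2 | h2
      · exact Or.inl ⟨(X.induced U).down_closed _ h2.1 _ hsub h0, A.down_closed _ h2.2 _ hsub h0⟩
      · rw [h2, Finset.subset_empty] at hsub
        exact Or.inr (Or.inl hsub)
      · exact absurd (hts hwt) h2
    · refine ⟨ht, fun _ => ?_, Or.inr (Or.inr hwt)⟩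
      by_cases hws : w ∈ s
      · rw [Finset.erase_eq_of_notMem hwt] at hsub
        rcases h2 with h2 | h2 | h2
        · exact (X.induced U).down_closed _ h2.1 _ hsub ht
        · rw [h2, Finset.subset_empty] at hsub
          exact absurd hsub ht.ne_empty
        · exact absurd hws h2
      · exact (X.induced U).down_closed _ (h1 hws) _ hts ht

theorem mem_attachCone_of_notMem {X : SComplex} {U : Set ℕ} {A : SComplex} {w : ℕ} {s : Finset ℕ}
    (hw : w ∉ s) : s ∈ (X.attachCone U A w).faces ↔ s ∈ (X.induced U).faces :=
  ⟨fun h => h.2.1 hw, fun h => ⟨X.nonempty_of_mem s h.1, fun _ => h, Or.inr (Or.inr hw)⟩⟩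

theorem insert_mem_attachCone {X : SComplex} {U : Set ℕ} {A : SComplex} {w : ℕ} {s : Finset ℕ}
    (hA : A.faces ⊆ (X.induced U).faces) (hw : w ∉ s) (hs : s.Nonempty) :
    insert w s ∈ (X.attachCone U A w).faces ↔ s ∈ A.faces := by
  constructor
  · rintro ⟨-, -, h⟩
    rw [Finset.erase_insert hw] at h
    rcases h with h | h | h
    · exact h.2
    · exact absurd h hs.ne_empty
    · exact absurd (Finset.mem_insert_self w s) h
  · intro h
    refine ⟨Finset.insert_nonempty _ _, fun h' => absurd (Finset.mem_insert_self w s) h', ?_⟩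
    rw [Finset.erase_insert hw]
    exact Or.inl ⟨hA h, h⟩

theorem apex_mem_vertexSet_attachCone (X : SComplex) (U : Set ℕ) (A : SComplex) (w : ℕ) :
    w ∈ (X.attachCone U A w).vertexSet :=
  ⟨Finset.singleton_nonempty w, fun h => absurd (Finset.mem_singleton_self w) h,
    Or.inr (Or.inl (by simp))⟩

theorem IsRado.ampleProp {X : SComplex} (hX : X.IsRado) : X.AmpleProp := by
  obtain ⟨-, huniv, hhom⟩ := hX
  intro U hU hUX A hA
  obtain ⟨w, hw⟩ := hU.exists_notMem
  obtain ⟨W, hWX, g, hbij, hg⟩ := huniv (X.attachCone U A w) (Set.to_countable _)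
  rw [vertexSet_induced, Set.inter_eq_left.2 hWX] at hbij
  have hwV := X.apex_mem_vertexSet_attachCone U A w
  have hUV : U ⊆ (X.attachCone U A w).vertexSet := by
    intro u hu
    have huw : w ∉ ({u} : Finset ℕ) := by
      rw [Finset.mem_singleton]
      rintro rfl
      exact hw hu
    exact (mem_attachCone_of_notMem huw).2 ⟨hUX hu, by simpa using hu⟩
  have hface : ∀ s : Finset ℕ, (s : Set ℕ) ⊆ (X.attachCone U A w).vertexSet →
      (s ∈ (X.attachCone U A w).faces ↔ s.image g ∈ X.faces) := by
    intro s hs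
    rw [hg s hs]
    refine ⟨fun h => h.1, fun h => ⟨h, ?_⟩⟩
    rw [Finset.coe_image]
    exact (hbij.mapsTo.mono_left hs).image_subset
  have hgU : g '' U ⊆ X.vertexSet := ((hbij.mapsTo.mono_left hUV).image_subset).trans hWX
  obtain ⟨F, ⟨hFbij, hFface⟩, hFg⟩ := hhom U (g '' U) hU (hU.image g) hUX hgU g (by
    refine ⟨?_, fun s hs => ?_⟩
    · rw [vertexSet_induced, vertexSet_induced, Set.inter_eq_left.2 hUX, Set.inter_eq_left.2 hgU]
      exact (hbij.injOn.mono hUV).bijOn_image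
    · rw [vertexSet_induced, Set.inter_eq_left.2 hUX] at hs
      rw [← mem_attachCone_of_notMem (A := A) (fun h => hw (hs h)), hface s (hs.trans hUV)]
      refine ⟨fun h => ⟨h, ?_⟩, fun h => h.1⟩
      rw [Finset.coe_image]
      exact Set.image_mono hs)
  obtain ⟨v, hv, hvw⟩ := hFbij.surjOn (hWX (hbij.mapsTo hwV))
  have hvU : v ∉ U := by
    intro h
    rw [hFg h] at hvw
    exact hw (hbij.injOn (hUV h) hwV hvw ▸ h)
  have key : ∀ s : Finset ℕ, (s : Set ℕ) ⊆ U → s.Nonempty →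
      (insert v s ∈ X.faces ↔ s ∈ A.faces) := by
    intro s hs hs0
    rw [← insert_mem_attachCone hA (fun h => hw (hs h)) hs0, hFface, hface, Finset.image_insert,
      Finset.image_insert, hvw, Finset.image_congr (hFg.mono hs)]
    · rw [Finset.coe_insert]
      exact Set.insert_subset hwV (hs.trans hUV)
    · rw [Finset.coe_insert]
      exact Set.insert_subset hv (hs.trans hUX)
  refine ⟨v, ⟨hv, hvU⟩, Set.ext fun s => ⟨?_, fun hs => ?_⟩⟩
  · rintro ⟨⟨hsX, -, hins⟩, -, hsU⟩
    exact (key s hsU (X.nonempty_of_mem s hsX)).1 hins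
  · have hsU := (hA hs).2
    exact ⟨⟨(hA hs).1, fun h => hvU (hsU h), (key s hsU (A.nonempty_of_mem s hs)).2 hs⟩, hA hs⟩

end SComplex

/-- A countable simplicial complex is a Rado complex if and only if
it is ample. -/
theorem rado_iff_ample (X : SComplex) (hc : X.vertexSet.Countable) :
    X.IsRado ↔ X.AmpleProp :=
  ⟨SComplex.IsRado.ampleProp, fun h => ⟨hc, h.universal, h.homogeneous⟩⟩
end

section
/- Let X be an ample simplicial complex, let L be a finite simplicial complex and L' ⊆ L an induced subcomplex of L, and let f' : L' → X_{U'} be an isomorphism of simplicial complexes, where U' ⊆ V(X) is a finite subset. Then there exists a finite subset U ⊆ V(X) containing U' and an isomorphism f : L → X_U whose restriction to L' equals f'. -/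
namespace SComplex

/-- `f` maps the subcomplex of `L` induced on `S` isomorphically onto an induced subcomplex
of `X`. -/
def IsEmbeddingOn (L X : SComplex) (S : Set ℕ) (f : ℕ → ℕ) : Prop :=
  Set.InjOn f S ∧ ∀ s : Finset ℕ, (↑s : Set ℕ) ⊆ S → (s ∈ L.faces ↔ s.image f ∈ X.faces)

theorem mem_vertexSet_induced {X : SComplex} {U : Set ℕ} {v : ℕ} :
    v ∈ (X.induced U).vertexSet ↔ v ∈ X.vertexSet ∧ v ∈ U := by
  simp [vertexSet, induced]

theorem vertexSet_induced_of_subset {X : SComplex} {U : Set ℕ} (hU : U ⊆ X.vertexSet) :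
    (X.induced U).vertexSet = U := by
  ext v
  exact mem_vertexSet_induced.trans ⟨And.right, fun h => ⟨hU h, h⟩⟩

namespace IsEmbeddingOn

variable {L X : SComplex} {S : Set ℕ} {f : ℕ → ℕ}

theorem image_subset_vertexSet (h : IsEmbeddingOn L X S f) (hS : S ⊆ L.vertexSet) :
    f '' S ⊆ X.vertexSet := by
  rintro _ ⟨x, hx, rfl⟩
  simpa [vertexSet] using (h.2 {x} (by simpa using hx)).mp (hS hx)

theorem isIso (h : IsEmbeddingOn L X L.vertexSet f) :
    IsIso L (X.induced (f '' L.vertexSet)) f := by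
  refine ⟨?_, fun s hs => ?_⟩
  · rw [vertexSet_induced_of_subset (h.image_subset_vertexSet subset_rfl)]
    exact h.1.bijOn_image
  · refine (h.2 s hs).trans ⟨fun hX => ⟨hX, ?_⟩, And.left⟩
    rw [Finset.coe_image]
    exact Set.image_mono hs

/-- The subcomplex of `X` onto which `f` maps those simplexes in `S` that span a simplex of `L`
together with `a`. -/
def imageLink (L : SComplex) (S : Set ℕ) (f : ℕ → ℕ) (a : ℕ) : SComplex where
  faces := {t | ∃ s : Finset ℕ, s.Nonempty ∧ (↑s : Set ℕ) ⊆ S ∧ insert a s ∈ L.faces ∧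
    s.image f = t}
  nonempty_of_mem := by
    rintro _ ⟨s, hs, -, -, rfl⟩
    exact hs.image f
  down_closed := by
    rintro _ ⟨s, -, hsS, hsL, rfl⟩ t hts ht
    obtain ⟨r, hrs, rfl⟩ := Finset.subset_image_iff.mp hts
    exact ⟨r, Finset.image_nonempty.mp ht, (Finset.coe_subset.mpr hrs).trans hsS,
      L.down_closed _ hsL _ (Finset.insert_subset_insert a hrs) (Finset.insert_nonempty a r), rfl⟩

theorem imageLink_faces_subset (h : IsEmbeddingOn L X S f) (a : ℕ) :
    (imageLink L S f a).faces ⊆ (X.induced (f '' S)).faces := by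
  rintro _ ⟨s, hs, hsS, hsL, rfl⟩
  refine ⟨(h.2 s hsS).mp (L.down_closed _ hsL _ (Finset.subset_insert a s) hs), ?_⟩
  rw [Finset.coe_image]
  exact Set.image_mono hsS

/-- In an ample complex, an embedding of a finite induced subcomplex extends to one more
vertex. -/
theorem exists_update (h : IsEmbeddingOn L X S f) (hX : X.AmpleProp) (hfin : S.Finite)
    (hS : S ⊆ L.vertexSet) {a : ℕ} (ha : a ∈ L.vertexSet) (haS : a ∉ S) :
    ∃ v, IsEmbeddingOn L X (insert a S) (Function.update f a v) := by
  obtain ⟨v, ⟨hvX, hvS⟩, hv⟩ := hX (f '' S) (hfin.image f) (h.image_subset_vertexSet hS)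
    (imageLink L S f a) (h.imageLink_faces_subset a)
  have heq : Set.EqOn (Function.update f a v) f S := fun x hx =>
    Function.update_of_ne (ne_of_mem_of_not_mem hx haS) v f
  have himage : ∀ s : Finset ℕ, (↑s : Set ℕ) ⊆ S →
      s.image (Function.update f a v) = s.image f := fun s hs =>
    Finset.image_congr (heq.mono hs)
  refine ⟨v, ?_, fun s hs => ?_⟩
  · rw [Set.injOn_insert haS, heq.image_eq, Function.update_self]
    exact ⟨h.1.congr heq.symm, hvS⟩
  by_cases has : a ∈ s
  · obtain ⟨r, har, rfl⟩ : ∃ r, a ∉ r ∧ insert a r = s :=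
      ⟨s.erase a, Finset.notMem_erase a s, Finset.insert_erase has⟩
    have hrS : (↑r : Set ℕ) ⊆ S := fun x hx =>
      (hs (Finset.mem_coe.mpr (Finset.mem_insert_of_mem hx))).resolve_left
        (fun hxa => har (hxa ▸ hx))
    rw [Finset.image_insert, Function.update_self, himage r hrS]
    rcases r.eq_empty_or_nonempty with rfl | hr
    · simpa [vertexSet] using iff_of_true ha hvX
    have hrU : (↑(r.image f) : Set ℕ) ⊆ f '' S := by
      rw [Finset.coe_image]
      exact Set.image_mono hrS
    constructor
    · intro hrL
      have hmem : r.image f ∈ (imageLink L S f a).faces := ⟨r, hr, hrS, hrL, rfl⟩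
      rw [← hv] at hmem
      exact hmem.1.2.2
    · intro hrX
      have hrX' : r.image f ∈ X.faces :=
        X.down_closed _ hrX _ (Finset.subset_insert v _) (hr.image f)
      have hmem : r.image f ∈ (X.link v).faces ∩ (X.induced (f '' S)).faces :=
        ⟨⟨hrX', fun hvr => hvS (hrU hvr), hrX⟩, hrX', hrU⟩
      rw [hv] at hmem
      obtain ⟨q, -, hqS, hqL, hqr⟩ := hmem
      have hqr' : q = r := by
        have hcoe : f '' (q : Set ℕ) = f '' (r : Set ℕ) := by
          rw [← Finset.coe_image, hqr, Finset.coe_image]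
        exact Finset.coe_injective ((h.1.image_eq_image_iff hqS hrS).mp hcoe)
      exact hqr' ▸ hqL
  · have hsS : (↑s : Set ℕ) ⊆ S := fun x hx =>
      (hs hx).resolve_left (fun hxa => has (hxa ▸ hx))
    rw [himage s hsS]
    exact h.2 s hsS

/-- In an ample complex, an embedding of a finite induced subcomplex extends to any finite set of
further vertices. -/
theorem exists_extend (h : IsEmbeddingOn L X S f) (hX : X.AmpleProp) (hfin : S.Finite)
    (hS : S ⊆ L.vertexSet) {T : Set ℕ} (hT : T.Finite) (hTL : T ⊆ L.vertexSet) :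
    ∃ g, IsEmbeddingOn L X (T ∪ S) g ∧ Set.EqOn g f S := by
  induction T, hT using Set.Finite.induction_on with
  | empty => exact ⟨f, by rwa [Set.empty_union], fun _ _ => rfl⟩
  | @insert a T _ hT ih =>
    obtain ⟨haL, hTL⟩ := Set.insert_subset_iff.mp hTL
    obtain ⟨g, hg, hgf⟩ := ih hTL
    rw [Set.insert_union]
    by_cases haTS : a ∈ T ∪ S
    · exact ⟨g, by rwa [Set.insert_eq_of_mem haTS], hgf⟩
    obtain ⟨v, hv⟩ := hg.exists_update hX (hT.union hfin) (Set.union_subset hTL hS) haL haTS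
    refine ⟨_, hv, fun x hx => ?_⟩
    rw [Function.update_of_ne (ne_of_mem_of_not_mem (Or.inr hx) haTS), hgf hx]

end IsEmbeddingOn

theorem IsIso.isEmbeddingOn {L L' X : SComplex} {U : Set ℕ} {f : ℕ → ℕ}
    (hf : IsIso L' (X.induced U) f) (hL' : IsInduced L' L) (hU : U ⊆ X.vertexSet) :
    IsEmbeddingOn L X L'.vertexSet f := by
  refine ⟨hf.1.injOn, fun s hs => ?_⟩
  have hsU : (↑(s.image f) : Set ℕ) ⊆ U := by
    rw [Finset.coe_image, ← vertexSet_induced_of_subset hU]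
    exact (hf.1.mapsTo.mono_left hs).image_subset
  calc s ∈ L.faces ↔ s ∈ L'.faces := ⟨fun h => hL'.2 s h hs, fun h => hL'.1 h⟩
    _ ↔ s.image f ∈ (X.induced U).faces := hf.2 s hs
    _ ↔ s.image f ∈ X.faces := ⟨And.left, fun h => ⟨h, hsU⟩⟩

end SComplex

/-- (Lemma 16 of the paper.) Let `X` be ample, `L` a finite simplicial
complex, `L' ⊆ L` an induced subcomplex and `f' : L' → X_{U'}` an isomorphism, `U' ⊆ V(X)`
finite.  Then there is a finite `U ⊆ V(X)` containing `U'` and an isomorphism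
`f : L → X_U` restricting to `f'` on `L'`. -/
theorem ample_extension (X : SComplex) (hX : X.IsAmple)
    (L L' : SComplex) (hLfin : L.vertexSet.Finite) (hL' : SComplex.IsInduced L' L)
    (U' : Set ℕ) (hU'fin : U'.Finite) (hU'sub : U' ⊆ X.vertexSet)
    (f' : ℕ → ℕ) (hf' : SComplex.IsIso L' (X.induced U') f') :
    ∃ U : Set ℕ, U.Finite ∧ U' ⊆ U ∧ U ⊆ X.vertexSet ∧
      ∃ f : ℕ → ℕ, SComplex.IsIso L (X.induced U) f ∧ Set.EqOn f f' L'.vertexSet := by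
  have hsub : L'.vertexSet ⊆ L.vertexSet := fun _ hv => hL'.1 hv
  have hemb := hf'.isEmbeddingOn hL' hU'sub
  obtain ⟨f, hf, hff'⟩ := hemb.exists_extend hX.2 (hLfin.subset hsub) hsub hLfin subset_rfl
  rw [Set.union_eq_left.mpr hsub] at hf
  refine ⟨f '' L.vertexSet, hLfin.image f, ?_, hf.image_subset_vertexSet subset_rfl, f,
    hf.isIso, hff'⟩
  rw [← SComplex.vertexSet_induced_of_subset hU'sub, ← hf'.1.image_eq, ← hff'.image_eq]
  exact Set.image_mono hsub
end
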